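/- Almost sure posterior convergence: assume the SBM parameters (α*, π*) satisfy (A1), (A2), (A3). Then, ℙ-almost surely, Σ_{[z_{[n]}] ≠ [Z_{[n]}]} P_{α*,π*}([z_{[n]}] | X_{[n]}) / P_{α*,π*}([Z_{[n]}] | X_{[n]}) → 0 as n → ∞; consequently P_{α*,π*}([Z_{[n]}] | X_{[n]}) → 1 ℙ-almost surely, and for every fixed equivalence class different from that of the true labels the posterior probability tends to 0 ℙ-almost surely. -/

import Mathlib

open scoped Classical
open Finset Filter MeasureTheory

/-- Product of Bernoulli masses: the conditional probability `P(X = x | Z = z)` in the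
directed binary SBM (diagonal terms are ignored). -/
noncomputable def bernW {Q n : ℕ} (π : Fin Q → Fin Q → ℝ) (z : Fin n → Fin Q)
    (x : Fin n → Fin n → Bool) : ℝ :=
  ∏ i : Fin n, ∏ j : Fin n,
    if i = j then 1 else (if x i j then π (z i) (z j) else 1 - π (z i) (z j))

/-- Unnormalized posterior weight of the label vector `z` given the adjacency matrix `x`:
`(Π_i α_{z_i}) · Π_{i≠j} π_{z_i,z_j}^{x_{i,j}}(1−π_{z_i,z_j})^{1−x_{i,j}}`; this is also the
joint SBM probability `P(Z = z, X = x)`. -/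
noncomputable def postW {Q n : ℕ} (α : Fin Q → ℝ) (π : Fin Q → Fin Q → ℝ)
    (x : Fin n → Fin n → Bool) (z : Fin n → Fin Q) : ℝ :=
  (∏ i : Fin n, α (z i)) * bernW π z x

/-- The conditional law `P* = P(· | Z = z*)` of the adjacency matrix, as a probability
of an event `E`. -/
noncomputable def condProb {Q n : ℕ} (π : Fin Q → Fin Q → ℝ) (zs : Fin n → Fin Q)
    (E : Set (Fin n → Fin n → Bool)) : ℝ :=
  ∑ x : Fin n → Fin n → Bool, if x ∈ E then bernW π zs x else 0

/-- The unconditional SBM law `ℙ` of the pair (labels, adjacency matrix), as a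
probability of an event `E`. -/
noncomputable def jointProb {Q n : ℕ} (α : Fin Q → ℝ) (π : Fin Q → Fin Q → ℝ)
    (E : Set ((Fin n → Fin Q) × (Fin n → Fin n → Bool))) : ℝ :=
  ∑ z : Fin n → Fin Q, ∑ x : Fin n → Fin n → Bool,
    if (z, x) ∈ E then postW α π x z else 0

/-- Assumption (A1): no two distinct classes have simultaneously equal rows and columns. -/
def A1 {Q : ℕ} (π : Fin Q → Fin Q → ℝ) : Prop :=
  ∀ q q' : Fin Q, q ≠ q' → ∃ l, π q l ≠ π q' l ∨ π l q ≠ π l q'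

/-- Assumption (A2): every entry of `π` lying in `(0,1)` lies in `[ζ, 1−ζ]`. -/
def A2 {Q : ℕ} (ζ : ℝ) (π : Fin Q → Fin Q → ℝ) : Prop :=
  ∀ q l, π q l ∈ Set.Ioo (0:ℝ) 1 → π q l ∈ Set.Icc ζ (1 - ζ)

/-- Assumption (A3): all group proportions lie in `[γ, 1−γ]`. -/
def A3 {Q : ℕ} (γ : ℝ) (α : Fin Q → ℝ) : Prop :=
  ∀ q, α q ∈ Set.Icc γ (1 - γ)

/-- `α` is a probability vector. -/
def ProbVec {Q : ℕ} (α : Fin Q → ℝ) : Prop := (∀ q, 0 ≤ α q) ∧ ∑ q, α q = 1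

/-- All entries of `π` lie in `[0,1]`. -/
def MatIcc {Q : ℕ} (π : Fin Q → Fin Q → ℝ) : Prop := ∀ q l, π q l ∈ Set.Icc (0:ℝ) 1

/-- `π`-equivalence of label vectors: equality up to a permutation of the classes
leaving `π` invariant. -/
def piEquiv {Q n : ℕ} (π : Fin Q → Fin Q → ℝ) (z z' : Fin n → Fin Q) : Prop :=
  ∃ σ : Equiv.Perm (Fin Q), (∀ q l, π (σ q) (σ l) = π q l) ∧ ∀ i, z' i = σ (z i)
/-- Sum over `π`-equivalence classes `[z] ≠ [z*]` of the posterior ratios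
`P([z] | x) / P([z*] | x)`, written as a weight ratio. -/
noncomputable def classRatioSum {Q n : ℕ} (α : Fin Q → ℝ) (π : Fin Q → Fin Q → ℝ)
    (x : Fin n → Fin n → Bool) (zs : Fin n → Fin Q) : ℝ :=
  (∑ z ∈ Finset.univ.filter (fun z => ¬ piEquiv π zs z), postW α π x z) /
  (∑ z ∈ Finset.univ.filter (fun z => piEquiv π zs z), postW α π x z)

/-- Posterior probability of the `π`-equivalence class of `z` given `x`. -/
noncomputable def classPosterior {Q n : ℕ} (α : Fin Q → ℝ) (π : Fin Q → Fin Q → ℝ)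
    (x : Fin n → Fin n → Bool) (z : Fin n → Fin Q) : ℝ :=
  (∑ z' ∈ Finset.univ.filter (fun z' => piEquiv π z z'), postW α π x z') /
  (∑ z' : Fin n → Fin Q, postW α π x z')

/-- Restriction of an infinite label sequence to the first `n` vertices. -/
def restrictZ {Q : ℕ} (z : ℕ → Fin Q) (n : ℕ) : Fin n → Fin Q := fun i => z i

/-- Restriction of an infinite adjacency array to the first `n` vertices. -/
def restrictX (x : ℕ → ℕ → Bool) (n : ℕ) : Fin n → Fin n → Bool := fun i j => x i j

lemma aux_bc_le {p q : ℝ} (hp : p ∈ Set.Icc (0:ℝ) 1) (hq : q ∈ Set.Icc (0:ℝ) 1) :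
    Real.sqrt (p * q) + Real.sqrt ((1 - p) * (1 - q)) ≤ 1 := by
  obtain ⟨h1, h2⟩ := hp
  obtain ⟨h3, h4⟩ := hq
  have e1 : Real.sqrt (p * q) ≤ (p + q) / 2 := by
    apply Real.sqrt_le_iff.2
    constructor <;> nlinarith [sq_nonneg (p - q)]
  have e2 : Real.sqrt ((1 - p) * (1 - q)) ≤ (2 - p - q) / 2 := by
    apply Real.sqrt_le_iff.2
    constructor <;> nlinarith [sq_nonneg (p - q)]
  linarith

lemma aux_bc_lt {p q : ℝ} (hp : p ∈ Set.Icc (0:ℝ) 1) (hq : q ∈ Set.Icc (0:ℝ) 1)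
    (hpq : p ≠ q) :
    Real.sqrt (p * q) + Real.sqrt ((1 - p) * (1 - q)) < 1 := by
  obtain ⟨h1, h2⟩ := hp
  obtain ⟨h3, h4⟩ := hq
  have hs : 0 < (p - q) ^ 2 := by
    have : p - q ≠ 0 := sub_ne_zero.2 hpq
    positivity
  have hpos : 0 < p + q := by
    rcases h1.lt_or_eq with h | h
    · linarith
    · rcases h3.lt_or_eq with h' | h'
      · linarith
      · exact absurd (h.symm.trans h') hpq
  have e1 : Real.sqrt (p * q) < (p + q) / 2 := by
    rw [Real.sqrt_lt' (by linarith)]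
    nlinarith
  have e2 : Real.sqrt ((1 - p) * (1 - q)) ≤ (2 - p - q) / 2 := by
    apply Real.sqrt_le_iff.2
    constructor <;> nlinarith [sq_nonneg (p - q)]
  linarith

lemma aux_exists_rho {Q : ℕ} (π : Fin Q → Fin Q → ℝ) (hmat : MatIcc π) :
    ∃ ρ : ℝ, 0 < ρ ∧ ρ < 1 ∧ ∀ a b c d, π a b ≠ π c d →
      Real.sqrt (π a b * π c d) + Real.sqrt ((1 - π a b) * (1 - π c d)) ≤ ρ := by
  let f : Option ((Fin Q × Fin Q) × (Fin Q × Fin Q)) → ℝ := fun o => match o with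
    | none => 1 / 2
    | some t => if π t.1.1 t.1.2 ≠ π t.2.1 t.2.2 then
        Real.sqrt (π t.1.1 t.1.2 * π t.2.1 t.2.2) +
          Real.sqrt ((1 - π t.1.1 t.1.2) * (1 - π t.2.1 t.2.2)) else 1 / 2
  obtain ⟨o, ho⟩ := Finite.exists_max f
  have h0 : (1:ℝ) / 2 ≤ f o := ho none
  refine ⟨f o, by linarith, ?_, ?_⟩
  · match o with
    | none => norm_num [f]
    | some t =>
      simp only [f]
      split_ifs with h
      · exact aux_bc_lt (hmat _ _) (hmat _ _) h
      · norm_num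
  · intro a b c d h
    have := ho (some ((a, b), (c, d)))
    simpa only [f, if_pos h] using this

/-- Number of ordered pairs on which the two label vectors give distinct edge probabilities. -/
noncomputable def auxD {Q n : ℕ} (π : Fin Q → Fin Q → ℝ) (z w : Fin n → Fin Q) : ℕ :=
  (univ.filter (fun p : Fin n × Fin n =>
    p.1 ≠ p.2 ∧ π (z p.1) (z p.2) ≠ π (w p.1) (w p.2))).card

/-- Hamming distance. -/
noncomputable def auxH {Q n : ℕ} (z w : Fin n → Fin Q) : ℕ :=
  (univ.filter (fun i : Fin n => z i ≠ w i)).card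

/-- Mass of one entry of the adjacency matrix, the diagonal being set to false. -/
noncomputable def auxG {Q n : ℕ} (π : Fin Q → Fin Q → ℝ) (z : Fin n → Fin Q)
    (i j : Fin n) (b : Bool) : ℝ :=
  if i = j then (if b then 0 else 1) else (if b then π (z i) (z j) else 1 - π (z i) (z j))

/-- Conditional law of the adjacency matrix with diagonal set to false. -/
noncomputable def auxB {Q n : ℕ} (π : Fin Q → Fin Q → ℝ) (z : Fin n → Fin Q)
    (x : Fin n → Fin n → Bool) : ℝ :=
  ∏ i : Fin n, ∏ j : Fin n, auxG π z i j (x i j)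

lemma auxG_nonneg {Q n : ℕ} {π : Fin Q → Fin Q → ℝ} (hmat : MatIcc π) (z : Fin n → Fin Q)
    (i j : Fin n) (b : Bool) : 0 ≤ auxG π z i j b := by
  unfold auxG
  have := hmat (z i) (z j)
  obtain ⟨h1, h2⟩ := this
  split_ifs <;> linarith

lemma auxB_nonneg {Q n : ℕ} {π : Fin Q → Fin Q → ℝ} (hmat : MatIcc π) (z : Fin n → Fin Q)
    (x : Fin n → Fin n → Bool) : 0 ≤ auxB π z x :=
  prod_nonneg fun i _ => prod_nonneg fun j _ => auxG_nonneg hmat z i j _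

lemma bernW_nonneg' {Q n : ℕ} {π : Fin Q → Fin Q → ℝ} (hmat : MatIcc π) (z : Fin n → Fin Q)
    (x : Fin n → Fin n → Bool) : 0 ≤ bernW π z x := by
  refine prod_nonneg fun i _ => prod_nonneg fun j _ => ?_
  obtain ⟨h1, h2⟩ := hmat (z i) (z j)
  split_ifs <;> linarith

lemma auxB_eq {Q n : ℕ} (π : Fin Q → Fin Q → ℝ) (z : Fin n → Fin Q)
    (x : Fin n → Fin n → Bool) (hx : ∀ i, x i i = false) : auxB π z x = bernW π z x := by
  refine prod_congr rfl fun i _ => prod_congr rfl fun j _ => ?_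
  unfold auxG
  by_cases h : i = j
  · subst h; simp [hx]
  · simp [h]

lemma auxB_eq_zero {Q n : ℕ} (π : Fin Q → Fin Q → ℝ) (z : Fin n → Fin Q)
    (x : Fin n → Fin n → Bool) (i : Fin n) (hx : x i i = true) : auxB π z x = 0 := by
  refine prod_eq_zero (mem_univ i) (prod_eq_zero (mem_univ i) ?_)
  simp [auxG, hx]

lemma aux_sum_prod {n : ℕ} (g : Fin n → Fin n → Bool → ℝ) :
    ∑ x : Fin n → Fin n → Bool, ∏ i, ∏ j, g i j (x i j) = ∏ i, ∏ j, ∑ b, g i j b := by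
  have h := Finset.prod_univ_sum (fun _ : Fin n => (univ : Finset (Fin n → Bool)))
    (fun i (y : Fin n → Bool) => ∏ j, g i j (y j))
  rw [Fintype.piFinset_univ] at h
  rw [← h]
  refine prod_congr rfl fun i _ => ?_
  have h2 := Finset.prod_univ_sum (fun _ : Fin n => (univ : Finset Bool)) (g i)
  rw [Fintype.piFinset_univ] at h2
  exact h2.symm

lemma aux_sum_B {Q n : ℕ} (π : Fin Q → Fin Q → ℝ) (z : Fin n → Fin Q) :
    ∑ x, auxB π z x = 1 := by
  unfold auxB
  rw [aux_sum_prod]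
  refine prod_eq_one fun i _ => prod_eq_one fun j _ => ?_
  unfold auxG
  by_cases h : i = j <;> simp [h]

lemma aux_sqrt_prod {ι : Type*} (s : Finset ι) (f : ι → ℝ) (hf : ∀ i, 0 ≤ f i) :
    Real.sqrt (∏ i ∈ s, f i) = ∏ i ∈ s, Real.sqrt (f i) := by
  induction s using Finset.induction_on with
  | empty => simp
  | insert a s ha ih => rw [prod_insert ha, prod_insert ha, Real.sqrt_mul (hf a), ih]

lemma aux_sqrt_sum {ι : Type*} (s : Finset ι) (f : ι → ℝ) (hf : ∀ i, 0 ≤ f i) :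
    Real.sqrt (∑ i ∈ s, f i) ≤ ∑ i ∈ s, Real.sqrt (f i) := by
  induction s using Finset.induction_on with
  | empty => simp
  | insert a s ha ih =>
    rw [sum_insert ha, sum_insert ha]
    have h1 := Real.sqrt_nonneg (f a)
    have h2 := Real.sqrt_nonneg (∑ i ∈ s, f i)
    have h3 := Real.sq_sqrt (hf a)
    have h4 := Real.sq_sqrt (sum_nonneg fun i (_ : i ∈ s) => hf i)
    have : Real.sqrt (f a + ∑ i ∈ s, f i) ≤ Real.sqrt (f a) + Real.sqrt (∑ i ∈ s, f i) := by
      apply Real.sqrt_le_iff.2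
      constructor <;> nlinarith
    linarith

lemma aux_bhatt {Q n : ℕ} {π : Fin Q → Fin Q → ℝ} (hmat : MatIcc π) {ρ : ℝ}
    (hρ : ∀ a b c d, π a b ≠ π c d →
      Real.sqrt (π a b * π c d) + Real.sqrt ((1 - π a b) * (1 - π c d)) ≤ ρ)
    (z w : Fin n → Fin Q) :
    ∑ x, Real.sqrt (auxB π z x * auxB π w x) ≤ ρ ^ auxD π z w := by
  have h1 : ∀ x, Real.sqrt (auxB π z x * auxB π w x) =
      ∏ i, ∏ j, Real.sqrt (auxG π z i j (x i j) * auxG π w i j (x i j)) := by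
    intro x
    unfold auxB
    rw [← prod_mul_distrib, aux_sqrt_prod]
    · refine prod_congr rfl fun i _ => ?_
      rw [← prod_mul_distrib, aux_sqrt_prod]
      exact fun j => mul_nonneg (auxG_nonneg hmat _ _ _ _) (auxG_nonneg hmat _ _ _ _)
    · exact fun i => mul_nonneg (prod_nonneg fun j _ => auxG_nonneg hmat _ _ _ _)
        (prod_nonneg fun j _ => auxG_nonneg hmat _ _ _ _)
  simp_rw [h1]
  rw [aux_sum_prod (fun i j b => Real.sqrt (auxG π z i j b * auxG π w i j b))]
  have h2 : ρ ^ auxD π z w = ∏ i : Fin n, ∏ j : Fin n,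
      if i ≠ j ∧ π (z i) (z j) ≠ π (w i) (w j) then ρ else 1 := by
    rw [auxD, ← Finset.prod_product', ← prod_const, prod_filter]
    rfl
  rw [h2]
  refine prod_le_prod (fun i _ => prod_nonneg fun j _ => sum_nonneg fun b _ =>
    Real.sqrt_nonneg _) fun i _ => prod_le_prod (fun j _ => sum_nonneg fun b _ =>
    Real.sqrt_nonneg _) fun j _ => ?_
  rw [Fintype.sum_bool]
  unfold auxG
  by_cases hij : i = j
  · simp [hij]
  · simp only [hij, if_false, ne_eq, not_false_eq_true, true_and, if_true, Bool.false_eq_true]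
    split_ifs with h
    · exact aux_bc_le (hmat _ _) (hmat _ _)
    · exact hρ _ _ _ _ h

/-- Permutations of the classes leaving `π` invariant. -/
def auxAut {Q : ℕ} (π : Fin Q → Fin Q → ℝ) (σ : Equiv.Perm (Fin Q)) : Prop :=
  ∀ q l, π (σ q) (σ l) = π q l

lemma aux_comb {Q n : ℕ} (hQ : 0 < Q) {π : Fin Q → Fin Q → ℝ} (hA1 : A1 π)
    (zs z : Fin n → Fin Q) (t : ℝ) (ht : 1 ≤ t)
    (hbal : ∀ q, Q * t ≤ ((univ.filter (fun i => zs i = q)).card : ℝ)) :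
    ∃ σ : Equiv.Perm (Fin Q), auxAut π σ ∧
      (t * auxH z (fun i => σ (zs i)) ≤ auxD π z zs ∨ t * (t - 1) ≤ auxD π z zs) := by
  have : Nonempty (Fin Q) := ⟨⟨0, hQ⟩⟩
  have hpig : ∀ q, ∃ l, t ≤ ((univ.filter (fun i => zs i = q ∧ z i = l)).card : ℝ) := by
    intro q
    obtain ⟨l, -, hl⟩ := exists_le_card_fiber_of_nsmul_le_card_of_maps_to
      (s := univ.filter (fun i => zs i = q)) (t := (univ : Finset (Fin Q))) (f := z) (b := t)
      (fun _ _ => mem_univ _) univ_nonempty (by simpa using hbal q)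
    refine ⟨l, ?_⟩
    rwa [filter_filter] at hl
  choose f hf using hpig
  by_cases hauto : ∀ q l, π (f q) (f l) = π q l
  · have hinj : Function.Injective f := by
      intro q q' h
      by_contra hne
      obtain ⟨l, hl⟩ := hA1 q q' hne
      rcases hl with hl | hl
      · exact hl (by rw [← hauto q l, ← hauto q' l, h])
      · exact hl (by rw [← hauto l q, ← hauto l q', h])
    let σ : Equiv.Perm (Fin Q) := Equiv.ofBijective f (Finite.injective_iff_bijective.1 hinj)
    have hσ : ∀ q, σ q = f q := fun q => rfl
    refine ⟨σ, fun q l => hauto q l, Or.inl ?_⟩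
    unfold auxH auxD
    set D := univ.filter (fun p : Fin n × Fin n =>
      p.1 ≠ p.2 ∧ π (z p.1) (z p.2) ≠ π (zs p.1) (zs p.2)) with hD
    set B := univ.filter (fun i : Fin n => z i ≠ σ (zs i)) with hB
    let φ : Fin n × Fin n → Fin n := fun p => if p.1 ∈ B then p.1 else p.2
    have hcard : (D.card : ℝ) = ∑ i : Fin n, ((D.filter (fun p => φ p = i)).card : ℝ) := by
      rw [card_eq_sum_card_fiberwise (f := φ) (t := univ) (fun _ _ => by simp)]
      push_cast
      rfl
    rw [hcard]
    have hfib : ∀ i ∈ B, t ≤ ((D.filter (fun p => φ p = i)).card : ℝ) := by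
      intro i hi
      have hi' : z i ≠ σ (zs i) := by simpa [hB] using hi
      have hne : zs i ≠ σ.symm (z i) := by
        intro h
        apply hi'
        rw [h, Equiv.apply_symm_apply]
      have hzi : z i = f (σ.symm (z i)) := by
        rw [← hσ, Equiv.apply_symm_apply]
      obtain ⟨k, hk⟩ := hA1 _ _ hne
      refine (hf k).trans ?_
      have hgood : ∀ j, zs j = k ∧ z j = f k → j ∉ B := by
        rintro j ⟨h1, h2⟩
        simp [hB, h1, h2, hσ]
      rcases hk with hk | hk
      · have : (univ.filter (fun i => zs i = k ∧ z i = f k)).card ≤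
            (D.filter (fun p => φ p = i)).card := by
          refine card_le_card_of_injOn (fun j => (i, j)) ?_ ?_
          · intro j hj
            simp only [coe_filter, mem_univ, true_and, Set.mem_ofPred_eq] at hj
            simp only [coe_filter, Set.mem_ofPred_eq, hD, mem_filter, mem_univ, true_and]
            refine ⟨⟨?_, ?_⟩, ?_⟩
            · rintro rfl
              exact hgood _ hj hi
            · rw [hj.1, hj.2, hzi, hauto]
              exact fun h => hk h.symm
            · simp only [φ, if_pos hi]
          · intro a _ b _ h
            simpa using h
        exact_mod_cast this
      · have : (univ.filter (fun i => zs i = k ∧ z i = f k)).card ≤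
            (D.filter (fun p => φ p = i)).card := by
          refine card_le_card_of_injOn (fun j => (j, i)) ?_ ?_
          · intro j hj
            simp only [coe_filter, mem_univ, true_and, Set.mem_ofPred_eq] at hj
            simp only [coe_filter, Set.mem_ofPred_eq, hD, mem_filter, mem_univ, true_and]
            refine ⟨⟨?_, ?_⟩, ?_⟩
            · rintro rfl
              exact hgood _ hj hi
            · rw [hj.1, hj.2, hzi, hauto]
              exact fun h => hk h.symm
            · simp only [φ, if_neg (hgood j hj)]
          · intro a _ b _ h
            simpa using h
        exact_mod_cast this
    calc t * (B.card : ℝ) = ∑ i ∈ B, t := by simp [mul_comm]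
      _ ≤ ∑ i ∈ B, ((D.filter (fun p => φ p = i)).card : ℝ) := sum_le_sum hfib
      _ ≤ _ := sum_le_sum_of_subset_of_nonneg (subset_univ _) fun _ _ _ => by positivity
  · push Not at hauto
    obtain ⟨q, l, hql⟩ := hauto
    refine ⟨Equiv.refl _, fun _ _ => rfl, Or.inr ?_⟩
    unfold auxD
    set S := univ.filter (fun i => zs i = q ∧ z i = f q) with hS
    set T := univ.filter (fun i => zs i = l ∧ z i = f l) with hT
    set D := univ.filter (fun p : Fin n × Fin n =>
      p.1 ≠ p.2 ∧ π (z p.1) (z p.2) ≠ π (zs p.1) (zs p.2)) with hD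
    have h1 : S.card * T.card ≤ D.card + S.card := by
      rw [← card_product, ← card_filter_add_card_filter_not (s := S ×ˢ T) (fun p => p.1 ≠ p.2)]
      apply Nat.add_le_add
      · apply card_le_card
        intro p hp
        simp only [hS, hT, mem_filter, mem_product, mem_univ, true_and] at hp
        simp only [hD, mem_filter, mem_univ, true_and]
        refine ⟨hp.2, ?_⟩
        rw [hp.1.1.1, hp.1.1.2, hp.1.2.1, hp.1.2.2]
        exact hql
      · refine card_le_card_of_injOn Prod.fst ?_ ?_
        · intro p hp
          simp only [coe_filter, mem_product, Set.mem_ofPred_eq] at hp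
          exact hp.1.1
        · intro p hp p' hp' h
          simp only [coe_filter, Set.mem_ofPred_eq, not_not] at hp hp'
          ext1
          · exact h
          · rw [← hp.2, ← hp'.2, h]
    have h2 : (S.card : ℝ) * T.card ≤ D.card + S.card := by exact_mod_cast h1
    have h3 := hf q
    have h4 := hf l
    nlinarith

lemma aux_comb2 {Q n : ℕ} (hQ : 0 < Q) {π : Fin Q → Fin Q → ℝ} (hA1 : A1 π)
    (zs z : Fin n → Fin Q) (c : ℝ) (hc : 0 < c) (hc1 : c ≤ 1) (hn : 2 ≤ c * n)
    (hbal : ∀ q, Q * (c * n) ≤ ((univ.filter (fun i => zs i = q)).card : ℝ)) :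
    ∃ σ : Equiv.Perm (Fin Q), auxAut π σ ∧
      c ^ 2 / 2 * n * auxH z (fun i => σ (zs i)) ≤ auxD π z zs := by
  obtain ⟨σ, hσ, h⟩ := aux_comb hQ hA1 zs z (c * n) (by linarith) hbal
  refine ⟨σ, hσ, ?_⟩
  have hH : (auxH z (fun i => σ (zs i)) : ℝ) ≤ n := by
    have : auxH z (fun i => σ (zs i)) ≤ n := by
      unfold auxH
      exact (card_le_univ _).trans (by simp)
    exact_mod_cast this
  set H : ℝ := (auxH z (fun i => σ (zs i)) : ℝ)
  have hH0 : 0 ≤ H := by positivity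
  have hn0 : (0:ℝ) ≤ n := by positivity
  rcases h with h | h
  · refine le_trans ?_ h
    have : c ^ 2 / 2 ≤ c := by nlinarith
    exact mul_le_mul_of_nonneg_right (mul_le_mul_of_nonneg_right this hn0) hH0
  · refine le_trans ?_ h
    calc c ^ 2 / 2 * n * H ≤ c ^ 2 / 2 * n * n := by gcongr
      _ = (c * n) * (c * n / 2) := by ring
      _ ≤ _ := by
        apply mul_le_mul_of_nonneg_left _ (by positivity)
        linarith

lemma aux_pow_H {Q n : ℕ} (u : ℝ) (z w : Fin n → Fin Q) :
    u ^ auxH z w = ∏ i, if z i ≠ w i then u else 1 := by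
  rw [auxH, ← prod_const, prod_filter]

lemma aux_sum_H {Q n : ℕ} (u : ℝ) (hu : 0 ≤ u) (hu1 : n * (Q * u) ≤ 1) (w : Fin n → Fin Q) :
    ∑ z ∈ univ.filter (fun z => z ≠ w), u ^ auxH z w ≤ 2 * (n * (Q * u)) := by
  have h1 : ∑ z : Fin n → Fin Q, u ^ auxH z w ≤ (1 + Q * u) ^ n := by
    simp_rw [aux_pow_H]
    have h := Finset.prod_univ_sum (fun _ : Fin n => (univ : Finset (Fin Q)))
      (fun i q => if q ≠ w i then u else 1)
    rw [Fintype.piFinset_univ] at h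
    rw [← h]
    calc ∏ i : Fin n, ∑ q : Fin Q, (if q ≠ w i then u else 1)
        ≤ ∏ i : Fin n, (1 + Q * u) := by
          refine prod_le_prod (fun i _ => sum_nonneg fun q _ => by split_ifs <;> linarith) ?_
          intro i _
          calc ∑ q : Fin Q, (if q ≠ w i then u else 1)
              ≤ ∑ q : Fin Q, ((if q = w i then 1 else 0) + u) := by
                refine sum_le_sum fun q _ => ?_
                by_cases h : q = w i <;> simp [h, hu]
            _ = 1 + Q * u := by simp [sum_add_distrib]
      _ = _ := by simp
  have h2 : ∑ z : Fin n → Fin Q, u ^ auxH z w =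
      1 + ∑ z ∈ univ.filter (fun z => z ≠ w), u ^ auxH z w := by
    rw [← Finset.sum_filter_add_sum_filter_not univ (fun z => z = w)]
    congr 1
    rw [filter_eq']
    simp [auxH]
  have h3 : (1 + Q * u) ^ n ≤ Real.exp (n * (Q * u)) := by
    rw [Real.exp_nat_mul]
    have : 1 + Q * u ≤ Real.exp (Q * u) := by
      have := Real.add_one_le_exp (Q * u)
      linarith
    gcongr
  have h0 : 0 ≤ n * (Q * u) := by positivity
  have h4 := Real.abs_exp_sub_one_le (x := n * (Q * u)) (by rwa [abs_of_nonneg h0])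
  rw [abs_of_nonneg h0] at h4
  have h5 := le_abs_self (Real.exp (n * (Q * u)) - 1)
  linarith

lemma aux_alpha_ratio {Q n : ℕ} {α : Fin Q → ℝ} {γ : ℝ} (hγ0 : 0 < γ) (hA3 : A3 γ α)
    (z w : Fin n → Fin Q) :
    ∏ i, α (z i) ≤ γ⁻¹ ^ auxH z w * ∏ i, α (w i) := by
  rw [aux_pow_H, ← prod_mul_distrib]
  refine prod_le_prod (fun i _ => hγ0.le.trans (hA3 _).1) fun i _ => ?_
  split_ifs with h
  · have h1 := (hA3 (z i)).2
    have h2 := (hA3 (w i)).1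
    calc α (z i) ≤ 1 := by linarith
      _ = γ⁻¹ * γ := by field_simp
      _ ≤ γ⁻¹ * α (w i) := by gcongr
  · have h' : z i = w i := by simpa using h
    simp [h']

lemma aux_bernW_aut {Q n : ℕ} {π : Fin Q → Fin Q → ℝ} {σ : Equiv.Perm (Fin Q)}
    (hσ : auxAut π σ) (z : Fin n → Fin Q) (x : Fin n → Fin n → Bool) :
    bernW π (fun i => σ (z i)) x = bernW π z x := by
  unfold bernW
  refine prod_congr rfl fun i _ => prod_congr rfl fun j _ => ?_
  rw [hσ]

lemma aux_prod_alpha_pos {Q n : ℕ} {α : Fin Q → ℝ} {γ : ℝ} (hγ0 : 0 < γ) (hA3 : A3 γ α)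
    (z : Fin n → Fin Q) : 0 < ∏ i, α (z i) :=
  prod_pos fun i _ => hγ0.trans_le (hA3 _).1

lemma aux_postW_nonneg {Q n : ℕ} {α : Fin Q → ℝ} {π : Fin Q → Fin Q → ℝ} {γ : ℝ}
    (hmat : MatIcc π) (hγ0 : 0 < γ) (hA3 : A3 γ α) (x : Fin n → Fin n → Bool)
    (z : Fin n → Fin Q) : 0 ≤ postW α π x z :=
  mul_nonneg (aux_prod_alpha_pos hγ0 hA3 z).le (bernW_nonneg' hmat z x)

lemma aux_sqrt_ratio {Q n : ℕ} {α : Fin Q → ℝ} {π : Fin Q → Fin Q → ℝ} {γ : ℝ}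
    (hmat : MatIcc π) (hγ0 : 0 < γ) (hA3 : A3 γ α) (zs : Fin n → Fin Q)
    (σ : (Fin n → Fin Q) → Equiv.Perm (Fin Q)) (hσ : ∀ z, auxAut π (σ z))
    (x : Fin n → Fin n → Bool) (hx : ∀ i, x i i = false) (hpos : 0 < postW α π x zs) :
    Real.sqrt (classRatioSum α π x zs) * auxB π zs x ≤
      ∑ z ∈ univ.filter (fun z => ¬ piEquiv π zs z),
        Real.sqrt γ⁻¹ ^ auxH z (fun i => σ z (zs i)) * Real.sqrt (auxB π z x * auxB π zs x) := by
  have hb : 0 < bernW π zs x := pos_of_mul_pos_right hpos (aux_prod_alpha_pos hγ0 hA3 zs).le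
  unfold classRatioSum
  set A := ∑ z ∈ univ.filter (fun z => piEquiv π zs z), postW α π x z with hA
  have hAz : ∀ z, (∏ i, α (σ z (zs i))) * bernW π zs x ≤ A := by
    intro z
    have := single_le_sum (f := fun z => postW α π x z)
      (s := univ.filter (fun z => piEquiv π zs z))
      (fun z _ => aux_postW_nonneg hmat hγ0 hA3 x z) (a := fun i => σ z (zs i))
      (by simp only [mem_filter, mem_univ, true_and]; exact ⟨σ z, hσ z, fun _ => rfl⟩)
    refine le_trans (le_of_eq ?_) this
    simp only [postW]
    rw [aux_bernW_aut (hσ z)]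
  have hA0 : 0 < A := (mul_pos (aux_prod_alpha_pos hγ0 hA3 _) hb).trans_le (hAz zs)
  rw [sum_div]
  refine (mul_le_mul_of_nonneg_right (aux_sqrt_sum _ _ fun z =>
    div_nonneg (aux_postW_nonneg hmat hγ0 hA3 x z) hA0.le) (auxB_nonneg hmat zs x)).trans ?_
  rw [sum_mul]
  refine sum_le_sum fun z _ => ?_
  rw [auxB_eq π zs x hx, auxB_eq π z x hx]
  have hz := bernW_nonneg' hmat z x
  have e1 : Real.sqrt (postW α π x z / A) * bernW π zs x =
      Real.sqrt (postW α π x z / A * bernW π zs x ^ 2) := by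
    rw [Real.sqrt_mul (div_nonneg (aux_postW_nonneg hmat hγ0 hA3 x z) hA0.le),
      Real.sqrt_sq hb.le]
  have e2 : Real.sqrt γ⁻¹ ^ auxH z (fun i => σ z (zs i)) *
      Real.sqrt (bernW π z x * bernW π zs x) =
      Real.sqrt (γ⁻¹ ^ auxH z (fun i => σ z (zs i)) * (bernW π z x * bernW π zs x)) := by
    rw [Real.sqrt_mul (show 0 ≤ γ⁻¹ ^ auxH z (fun i => σ z (zs i)) by positivity)]
    congr 1
    have h := aux_sqrt_prod (univ : Finset (Fin (auxH z (fun i => σ z (zs i)))))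
      (fun _ => γ⁻¹) (fun _ => by positivity)
    simpa using h.symm
  rw [e1, e2]
  apply Real.sqrt_le_sqrt
  rw [div_mul_eq_mul_div, div_le_iff₀ hA0]
  have hr := aux_alpha_ratio hγ0 hA3 z (fun i => σ z (zs i))
  have hg : 0 ≤ γ⁻¹ ^ auxH z (fun i => σ z (zs i)) := by positivity
  calc postW α π x z * bernW π zs x ^ 2
      = (∏ i, α (z i)) * (bernW π z x * bernW π zs x ^ 2) := by
        unfold postW; ring
    _ ≤ (γ⁻¹ ^ auxH z (fun i => σ z (zs i)) * ∏ i, α (σ z (zs i))) *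
          (bernW π z x * bernW π zs x ^ 2) :=
        mul_le_mul_of_nonneg_right hr (by positivity)
    _ = γ⁻¹ ^ auxH z (fun i => σ z (zs i)) * (bernW π z x * bernW π zs x) *
          ((∏ i, α (σ z (zs i))) * bernW π zs x) := by ring
    _ ≤ _ := mul_le_mul_of_nonneg_left (hAz z) (by positivity)

lemma aux_ratio_nonneg {Q n : ℕ} {α : Fin Q → ℝ} {π : Fin Q → Fin Q → ℝ} {γ : ℝ}
    (hmat : MatIcc π) (hγ0 : 0 < γ) (hA3 : A3 γ α) (zs : Fin n → Fin Q)
    (x : Fin n → Fin n → Bool) : 0 ≤ classRatioSum α π x zs :=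
  div_nonneg (sum_nonneg fun z _ => aux_postW_nonneg hmat hγ0 hA3 x z)
    (sum_nonneg fun z _ => aux_postW_nonneg hmat hγ0 hA3 x z)

lemma aux_cond_bound {Q n : ℕ} (hQ : 0 < Q) {α : Fin Q → ℝ} {π : Fin Q → Fin Q → ℝ} {γ : ℝ}
    (hmat : MatIcc π) (hA1 : A1 π) (hγ0 : 0 < γ) (hA3 : A3 γ α) {ρ : ℝ}
    (hρ0 : 0 < ρ) (hρ1 : ρ < 1)
    (hρ : ∀ a b c d, π a b ≠ π c d →
      Real.sqrt (π a b * π c d) + Real.sqrt ((1 - π a b) * (1 - π c d)) ≤ ρ)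
    (zs : Fin n → Fin Q) (c : ℝ) (hc : 0 < c) (hc1 : c ≤ 1) (hn : 2 ≤ c * n)
    (hbal : ∀ q, Q * (c * n) ≤ ((univ.filter (fun i => zs i = q)).card : ℝ))
    (u : ℝ) (hu : u = Real.sqrt γ⁻¹ * (ρ ^ (c ^ 2 / 2)) ^ n) (hu1 : n * (Q * u) ≤ 1)
    (ε : ℝ) (hε : 0 < ε) :
    ∑ x, (if 0 < postW α π x zs ∧ ε ≤ classRatioSum α π x zs then auxB π zs x else 0) ≤
      (Real.sqrt ε)⁻¹ * (Fintype.card (Equiv.Perm (Fin Q)) * (2 * (n * (Q * u)))) := by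
  have hex : ∀ z : Fin n → Fin Q, ∃ σ : Equiv.Perm (Fin Q), auxAut π σ ∧
      c ^ 2 / 2 * n * auxH z (fun i => σ (zs i)) ≤ auxD π z zs :=
    fun z => aux_comb2 hQ hA1 zs z c hc hc1 hn hbal
  choose σ hσ hD using hex
  have hu0 : 0 ≤ u := by rw [hu]; positivity
  set N := univ.filter (fun z => ¬ piEquiv π zs z) with hN
  have hsε : 0 < Real.sqrt ε := Real.sqrt_pos.2 hε
  have step1 : ∀ x, (if 0 < postW α π x zs ∧ ε ≤ classRatioSum α π x zs then auxB π zs x else 0)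
      ≤ (Real.sqrt ε)⁻¹ * ∑ z ∈ N,
        Real.sqrt γ⁻¹ ^ auxH z (fun i => σ z (zs i)) *
          Real.sqrt (auxB π z x * auxB π zs x) := by
    intro x
    have hnn : 0 ≤ (Real.sqrt ε)⁻¹ * ∑ z ∈ N,
        Real.sqrt γ⁻¹ ^ auxH z (fun i => σ z (zs i)) *
          Real.sqrt (auxB π z x * auxB π zs x) := by positivity
    split_ifs with h
    · by_cases hx : ∀ i, x i i = false
      · have h1 := aux_sqrt_ratio hmat hγ0 hA3 zs σ hσ x hx h.1
        rw [inv_mul_eq_div, le_div_iff₀ hsε]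
        refine le_trans ?_ h1
        rw [mul_comm]
        exact mul_le_mul_of_nonneg_right (Real.sqrt_le_sqrt h.2) (auxB_nonneg hmat zs x)
      · push Not at hx
        obtain ⟨i, hi⟩ := hx
        exact (auxB_eq_zero π zs x i (by simpa using hi)).le.trans hnn
    · exact hnn
  refine (sum_le_sum fun x _ => step1 x).trans ?_
  rw [← mul_sum]
  refine mul_le_mul_of_nonneg_left ?_ (by positivity)
  rw [sum_comm]
  have step2 : ∀ z ∈ N, ∑ x, Real.sqrt γ⁻¹ ^ auxH z (fun i => σ z (zs i)) *
          Real.sqrt (auxB π z x * auxB π zs x) ≤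
      ∑ τ : Equiv.Perm (Fin Q), if z ≠ (fun i => τ (zs i)) then
        u ^ auxH z (fun i => τ (zs i)) else 0 := by
    intro z hz
    have hne : z ≠ (fun i => σ z (zs i)) := by
      intro h
      simp only [hN, mem_filter, mem_univ, true_and] at hz
      exact hz ⟨σ z, hσ z, fun i => congrFun h i⟩
    have h1 : ∑ x, Real.sqrt γ⁻¹ ^ auxH z (fun i => σ z (zs i)) *
          Real.sqrt (auxB π z x * auxB π zs x) ≤ u ^ auxH z (fun i => σ z (zs i)) := by
      rw [← mul_sum, hu, mul_pow]
      refine mul_le_mul_of_nonneg_left ?_ (by positivity)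
      refine (aux_bhatt hmat hρ z zs).trans ?_
      rw [← Real.rpow_natCast ρ, ← pow_mul, ← Real.rpow_natCast, ← Real.rpow_mul hρ0.le]
      apply Real.rpow_le_rpow_of_exponent_ge hρ0 hρ1.le
      refine le_trans (le_of_eq ?_) (hD z)
      push_cast
      ring
    refine h1.trans ?_
    have h2 := single_le_sum (f := fun τ : Equiv.Perm (Fin Q) =>
      if z ≠ (fun i => τ (zs i)) then u ^ auxH z (fun i => τ (zs i)) else 0) (s := univ)
      (fun τ _ => by split_ifs <;> positivity) (mem_univ (σ z))
    simpa only [if_pos hne] using h2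
  refine (sum_le_sum step2).trans ?_
  refine (sum_le_sum_of_subset_of_nonneg (subset_univ N) fun z _ _ =>
    sum_nonneg fun _ _ => by split_ifs <;> positivity).trans ?_
  rw [sum_comm]
  calc _ ≤ ∑ τ : Equiv.Perm (Fin Q), 2 * (n * (Q * u)) := by
        refine sum_le_sum fun τ _ => ?_
        rw [← sum_filter]
        exact aux_sum_H u hu0 hu1 _
    _ = _ := by simp

lemma aux_sum_pi {Q n : ℕ} (f : Fin Q → ℝ) :
    ∑ z : Fin n → Fin Q, ∏ i, f (z i) = (∑ q, f q) ^ n := by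
  have h := Finset.prod_univ_sum (fun _ : Fin n => (univ : Finset (Fin Q))) (fun _ q => f q)
  rw [Fintype.piFinset_univ] at h
  rw [← h]
  simp

/-- Every class has at least `a` members. -/
def auxBal {Q n : ℕ} (a : ℝ) (z : Fin n → Fin Q) : Prop :=
  ∀ q, a ≤ ((univ.filter (fun i => z i = q)).card : ℝ)

lemma aux_label {Q n : ℕ} {α : Fin Q → ℝ} {γ : ℝ} (hprob : ProbVec α) (hγ0 : 0 < γ)
    (hA3 : A3 γ α) :
    ∑ z : Fin n → Fin Q, (if ¬ auxBal (γ / 4 * n) z then ∏ i, α (z i) else 0) ≤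
      Q * Real.exp (-(γ / 4)) ^ n := by
  have h1 : ∀ z : Fin n → Fin Q, (if ¬ auxBal (γ / 4 * n) z then ∏ i, α (z i) else 0) ≤
      ∑ q : Fin Q, Real.exp (γ / 4 * n) *
        ∏ i, (α (z i) * (if z i = q then Real.exp (-1) else 1)) := by
    intro z
    have hp := aux_prod_alpha_pos hγ0 hA3 z
    have hterm : ∀ q : Fin Q, 0 ≤ Real.exp (γ / 4 * n) *
        ∏ i, (α (z i) * (if z i = q then Real.exp (-1) else 1)) := by
      intro q
      refine mul_nonneg (Real.exp_pos _).le (prod_nonneg fun i _ => mul_nonneg (hprob.1 _) ?_)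
      split_ifs <;> positivity
    split_ifs with h
    · exact sum_nonneg fun q _ => hterm q
    · unfold auxBal at h
      push Not at h
      obtain ⟨q, hq⟩ := h
      refine le_trans ?_ (single_le_sum (fun q _ => hterm q) (mem_univ q))
      rw [prod_mul_distrib, ← prod_filter, prod_const, ← Real.exp_nat_mul, mul_left_comm,
        ← Real.exp_add]
      apply le_mul_of_one_le_right hp.le
      apply Real.one_le_exp
      linarith
  refine (sum_le_sum fun z _ => h1 z).trans ?_
  rw [sum_comm]
  calc _ ≤ ∑ q : Fin Q, Real.exp (-(γ / 4)) ^ n := by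
        refine sum_le_sum fun q _ => ?_
        rw [← mul_sum, aux_sum_pi (fun l => α l * (if l = q then Real.exp (-1) else 1)),
          mul_comm (γ / 4), Real.exp_nat_mul, ← mul_pow]
        have hS : ∑ l, α l * (if l = q then Real.exp (-1) else 1) =
            1 - α q * (1 - Real.exp (-1)) := by
          have : ∀ l, α l * (if l = q then Real.exp (-1) else 1) =
              α l - (if l = q then α l * (1 - Real.exp (-1)) else 0) := by
            intro l
            split_ifs <;> ring
          simp_rw [this]
          rw [sum_sub_distrib, hprob.2]
          simp
        have he : Real.exp (-1) ≤ 1 / 2 := by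
          rw [Real.exp_neg, inv_le_comm₀ (Real.exp_pos _) (by norm_num)]
          have := Real.exp_one_gt_d9
          norm_num
          linarith
        have hle : ∑ l, α l * (if l = q then Real.exp (-1) else 1) ≤ Real.exp (-(γ / 2)) := by
          rw [hS]
          have h2 := Real.add_one_le_exp (-(γ / 2))
          have h3 := (hA3 q).1
          nlinarith
        have hnn : 0 ≤ ∑ l, α l * (if l = q then Real.exp (-1) else 1) :=
          sum_nonneg fun l _ => mul_nonneg (hprob.1 _) (by split_ifs <;> positivity)
        have hf : Real.exp (γ / 4) * ∑ l, α l * (if l = q then Real.exp (-1) else 1) ≤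
            Real.exp (-(γ / 4)) := by
          calc _ ≤ Real.exp (γ / 4) * Real.exp (-(γ / 2)) := by gcongr
            _ = _ := by rw [← Real.exp_add]; congr 1; ring
        exact pow_le_pow_left₀ (by positivity) hf n
    _ = _ := by simp

lemma aux_bernW_congr {Q n : ℕ} (π : Fin Q → Fin Q → ℝ) (z : Fin n → Fin Q)
    {x x' : Fin n → Fin n → Bool} (h : ∀ i j, i ≠ j → x i j = x' i j) :
    bernW π z x = bernW π z x' := by
  unfold bernW
  refine prod_congr rfl fun i _ => prod_congr rfl fun j _ => ?_
  by_cases hij : i = j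
  · simp [hij]
  · simp only [hij, if_false, h i j hij]

lemma aux_postW_congr {Q n : ℕ} (α : Fin Q → ℝ) (π : Fin Q → Fin Q → ℝ)
    {x x' : Fin n → Fin n → Bool} (h : ∀ i j, i ≠ j → x i j = x' i j) :
    postW α π x = postW α π x' := by
  funext z
  unfold postW
  rw [aux_bernW_congr π z h]

lemma aux_meas {Q n : ℕ} {α : Fin Q → ℝ} {π : Fin Q → Fin Q → ℝ} {γ : ℝ}
    (hmat : MatIcc π) (hγ0 : 0 < γ) (hA3 : A3 γ α)
    {Ω : Type*} [MeasurableSpace Ω] (μ : Measure Ω)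
    (Z : Ω → ℕ → Fin Q) (X : Ω → ℕ → ℕ → Bool)
    (hdist : ∀ (z : Fin n → Fin Q) (x : Fin n → Fin n → Bool),
      μ {ω | (∀ i : Fin n, Z ω i = z i) ∧ ∀ i j : Fin n, i ≠ j → X ω i j = x i j}
        = ENNReal.ofReal (postW α π x z))
    (E : (Fin n → Fin Q) → (Fin n → Fin n → Bool) → Prop)
    (hE : ∀ z x x', (∀ i j, i ≠ j → x i j = x' i j) → E z x → E z x') :
    μ {ω | E (restrictZ (Z ω) n) (restrictX (X ω) n)} ≤
      ENNReal.ofReal (∑ z, ∑ x, if E z x then (∏ i, α (z i)) * auxB π z x else 0) := by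
  set F := univ.filter (fun p : (Fin n → Fin Q) × (Fin n → Fin n → Bool) =>
    E p.1 p.2 ∧ ∀ i, p.2 i i = false) with hF
  have hsub : {ω | E (restrictZ (Z ω) n) (restrictX (X ω) n)} ⊆
      ⋃ p ∈ F, {ω | (∀ i : Fin n, Z ω i = p.1 i) ∧
        ∀ i j : Fin n, i ≠ j → X ω i j = p.2 i j} := by
    intro ω hω
    simp only [Set.mem_iUnion, exists_prop]
    refine ⟨(restrictZ (Z ω) n, fun i j => if i = j then false else restrictX (X ω) n i j),
      ?_, ?_, ?_⟩
    · simp only [hF, mem_filter, mem_univ, true_and]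
      refine ⟨hE _ _ _ ?_ hω, fun i => by simp⟩
      intro i j hij
      simp [hij]
    · intro i
      rfl
    · intro i j hij
      simp [hij, restrictX]
  refine (measure_mono hsub).trans ((measure_biUnion_finset_le _ _).trans ?_)
  simp_rw [hdist]
  rw [← ENNReal.ofReal_sum_of_nonneg fun p _ => aux_postW_nonneg hmat hγ0 hA3 _ _]
  apply ENNReal.ofReal_le_ofReal
  rw [← Fintype.sum_prod_type' (fun z x => if E z x then (∏ i, α (z i)) * auxB π z x else 0),
    hF, sum_filter]
  refine sum_le_sum fun p _ => ?_
  by_cases hp : E p.1 p.2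
  · by_cases hd : ∀ i, p.2 i i = false
    · rw [if_pos ⟨hp, hd⟩, if_pos hp, auxB_eq π _ _ hd]
      rfl
    · rw [if_neg (fun h => hd h.2), if_pos hp]
      exact mul_nonneg (aux_prod_alpha_pos hγ0 hA3 _).le (auxB_nonneg hmat _ _)
  · simp [hp]

lemma aux_total {Q n : ℕ} {α : Fin Q → ℝ} {π : Fin Q → Fin Q → ℝ} {γ : ℝ}
    (hprob : ProbVec α) (hmat : MatIcc π) (hγ0 : 0 < γ) (hA3 : A3 γ α)
    (ε a K : ℝ)  (hK : 0 ≤ K) (ha : a = γ / 4 * n)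
    (hcond : ∀ zs : Fin n → Fin Q, auxBal a zs →
      ∑ x, (if 0 < postW α π x zs ∧ ε ≤ classRatioSum α π x zs then auxB π zs x else 0) ≤ K) :
    ∑ z : Fin n → Fin Q, ∑ x, (if ¬ (0 < postW α π x z ∧ classRatioSum α π x z < ε) then
      (∏ i, α (z i)) * auxB π z x else 0) ≤ Q * Real.exp (-(γ / 4)) ^ n + K := by
  have h1 : ∀ z : Fin n → Fin Q,
      ∑ x, (if ¬ (0 < postW α π x z ∧ classRatioSum α π x z < ε) then
        (∏ i, α (z i)) * auxB π z x else 0) ≤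
      (if ¬ auxBal (γ / 4 * n) z then ∏ i, α (z i) else 0) + (∏ i, α (z i)) * K := by
    intro z
    have hp := aux_prod_alpha_pos hγ0 hA3 z
    by_cases hb : auxBal (γ / 4 * n) z
    · rw [if_neg (not_not.2 hb), zero_add]
      refine le_trans ?_ (mul_le_mul_of_nonneg_left (hcond z (ha ▸ hb)) hp.le)
      rw [mul_sum]
      refine sum_le_sum fun x _ => ?_
      by_cases hw : 0 < postW α π x z
      · by_cases hr : ε ≤ classRatioSum α π x z
        · rw [if_pos (by simp [hr]), if_pos ⟨hw, hr⟩]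
        · rw [if_neg (by simp [hw, not_le.1 hr]), if_neg (by simp [hr])]
          simp
      · rw [if_pos (by simp [hw]), if_neg (by simp [hw])]
        have : auxB π z x = 0 := by
          by_cases hx : ∀ i, x i i = false
          · rw [auxB_eq π z x hx]
            by_contra hne
            exact hw (mul_pos hp ((bernW_nonneg' hmat z x).lt_of_ne' hne))
          · push Not at hx
            obtain ⟨i, hi⟩ := hx
            exact auxB_eq_zero π z x i (by simpa using hi)
        simp [this]
    · rw [if_pos hb]
      have h2 : ∑ x, (if ¬ (0 < postW α π x z ∧ classRatioSum α π x z < ε) then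
        (∏ i, α (z i)) * auxB π z x else 0) ≤ ∑ x, (∏ i, α (z i)) * auxB π z x := by
        refine sum_le_sum fun x _ => ?_
        have := mul_nonneg hp.le (auxB_nonneg hmat z x)
        split_ifs <;> linarith
      rw [← mul_sum, aux_sum_B, mul_one] at h2
      have := mul_nonneg hp.le hK
      linarith
  refine (sum_le_sum fun z _ => h1 z).trans ?_
  rw [sum_add_distrib, ← sum_mul, aux_sum_pi, hprob.2, one_pow, one_mul]
  have := aux_label (n := n) hprob hγ0 hA3
  linarith

lemma aux_ae {Q : ℕ} (hQ : 0 < Q) {α : Fin Q → ℝ} {π : Fin Q → Fin Q → ℝ} {γ : ℝ}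
    (hprob : ProbVec α) (hmat : MatIcc π) (hA1 : A1 π) (hγ0 : 0 < γ) (hA3 : A3 γ α)
    {Ω : Type*} [MeasurableSpace Ω] (μ : Measure Ω)
    (Z : Ω → ℕ → Fin Q) (X : Ω → ℕ → ℕ → Bool)
    (hdist : ∀ (n : ℕ) (z : Fin n → Fin Q) (x : Fin n → Fin n → Bool),
      μ {ω | (∀ i : Fin n, Z ω i = z i) ∧ ∀ i j : Fin n, i ≠ j → X ω i j = x i j}
        = ENNReal.ofReal (postW α π x z)) (ε : ℝ) (hε : 0 < ε) :
    ∀ᵐ ω ∂μ, ∀ᶠ n in atTop,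
      0 < postW α π (restrictX (X ω) n) (restrictZ (Z ω) n) ∧
      classRatioSum α π (restrictX (X ω) n) (restrictZ (Z ω) n) < ε := by
  obtain ⟨ρ, hρ0, hρ1, hρ⟩ := aux_exists_rho π hmat
  have hQ' : (0:ℝ) < Q := by exact_mod_cast hQ
  have hQ1 : (1:ℝ) ≤ Q := by exact_mod_cast hQ
  set c : ℝ := γ / 4 / Q with hc
  have hc0 : 0 < c := by positivity
  have hγ1 : γ ≤ 1 := by
    have h1 := (hA3 ⟨0, hQ⟩).1
    have h2 := (hA3 ⟨0, hQ⟩).2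
    linarith
  have hc1 : c ≤ 1 := by
    rw [hc, div_le_one hQ']
    linarith
  have hQc : Q * c = γ / 4 := by rw [hc]; field_simp
  set β : ℝ := ρ ^ (c ^ 2 / 2) with hβ
  have hβ0 : 0 < β := Real.rpow_pos_of_pos hρ0 _
  have hβ1 : β < 1 := Real.rpow_lt_one hρ0.le hρ1 (by positivity)
  let K : ℕ → ℝ := fun n => (Real.sqrt ε)⁻¹ * (Fintype.card (Equiv.Perm (Fin Q)) *
    (2 * (n * (Q * (Real.sqrt γ⁻¹ * β ^ n)))))
  let b : ℕ → ℝ := fun n => Q * Real.exp (-(γ / 4)) ^ n + K n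
  have hK0 : ∀ n, 0 ≤ K n := fun n => by positivity
  have hsb : Summable b := by
    apply Summable.add
    · apply Summable.mul_left
      exact summable_geometric_of_lt_one (Real.exp_pos _).le
        (by rw [Real.exp_lt_one_iff]; linarith)
    · have h := summable_pow_mul_geometric_of_norm_lt_one 1
        (show ‖β‖ < 1 by rwa [Real.norm_of_nonneg hβ0.le])
      have h2 := h.mul_left ((Real.sqrt ε)⁻¹ * (Fintype.card (Equiv.Perm (Fin Q)) *
        (2 * (Q * Real.sqrt γ⁻¹))))
      refine h2.congr fun n => ?_
      simp only [K]
      ring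
  have hev1 : ∀ᶠ n : ℕ in atTop, 2 ≤ c * n :=
    (tendsto_natCast_atTop_atTop.const_mul_atTop hc0).eventually_ge_atTop 2
  have hev2 : ∀ᶠ n : ℕ in atTop, n * (Q * (Real.sqrt γ⁻¹ * β ^ n)) ≤ 1 := by
    have h := (tendsto_self_mul_const_pow_of_lt_one hβ0.le hβ1).const_mul (Q * Real.sqrt γ⁻¹)
    rw [mul_zero] at h
    filter_upwards [h.eventually_le_const one_pos] with n hn
    refine le_trans (le_of_eq ?_) hn
    ring
  obtain ⟨N, hN⟩ := eventually_atTop.1 (hev1.and hev2)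
  let s : ℕ → Set Ω := fun n => {ω |
    ¬ (0 < postW α π (restrictX (X ω) n) (restrictZ (Z ω) n) ∧
      classRatioSum α π (restrictX (X ω) n) (restrictZ (Z ω) n) < ε)}
  have hs : ∀ n, N ≤ n → μ (s n) ≤ ENNReal.ofReal (b n) := by
    intro n hn
    obtain ⟨hn1, hn2⟩ := hN n hn
    have h1 := aux_meas hmat hγ0 hA3 μ Z X (hdist n)
      (fun z x => ¬ (0 < postW α π x z ∧ classRatioSum α π x z < ε)) (by
        intro z x x' h
        simp only [classRatioSum]
        rw [aux_postW_congr α π h]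
        exact id)
    refine h1.trans (ENNReal.ofReal_le_ofReal ?_)
    have h2 := aux_total hprob hmat hγ0 hA3 ε (γ / 4 * n) (K n) (hK0 n) rfl ?_
    · convert h2 using 4
    intro zs hbal
    refine aux_cond_bound hQ hmat hA1 hγ0 hA3 hρ0 hρ1 hρ zs c hc0 hc1 hn1 ?_ _ rfl hn2 ε hε
    intro q
    rw [← mul_assoc, hQc]
    exact hbal q
  have hsum : ∑' n, μ (s (n + N)) ≠ ⊤ := by
    have h1 : ∑' n, μ (s (n + N)) ≤ ∑' n, ENNReal.ofReal (b (n + N)) :=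
      ENNReal.tsum_le_tsum fun n => hs _ (by omega)
    have h2 := ((summable_nat_add_iff N).2 hsb).tsum_ofReal_ne_top
    exact ne_top_of_le_ne_top h2 h1
  filter_upwards [ae_eventually_notMem hsum] with ω hω
  obtain ⟨M, hM⟩ := eventually_atTop.1 hω
  refine eventually_atTop.2 ⟨M + N, fun n hn => ?_⟩
  have := hM (n - N) (by omega)
  rw [Nat.sub_add_cancel (by omega)] at this
  exact not_not.1 this

lemma aux_posterior_eq {Q n : ℕ} {α : Fin Q → ℝ} {π : Fin Q → Fin Q → ℝ} {γ : ℝ}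
    (hmat : MatIcc π) (hγ0 : 0 < γ) (hA3 : A3 γ α) (zs : Fin n → Fin Q)
    (x : Fin n → Fin n → Bool) (hpos : 0 < postW α π x zs) :
    classPosterior α π x zs = (1 + classRatioSum α π x zs)⁻¹ := by
  unfold classPosterior classRatioSum
  have hA : 0 < ∑ z ∈ univ.filter (fun z => piEquiv π zs z), postW α π x z :=
    hpos.trans_le (single_le_sum (fun z _ => aux_postW_nonneg hmat hγ0 hA3 x z)
      (by simp only [mem_filter, mem_univ, true_and]
          exact ⟨Equiv.refl _, fun _ _ => rfl, fun _ => rfl⟩))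
  rw [← sum_filter_add_sum_filter_not univ (fun z => piEquiv π zs z)]
  field_simp

/-- Almost sure posterior convergence: for any process `(Z, X)` whose finite-dimensional
distributions are those of the SBM with parameters `(α*, π*)` satisfying (A1)–(A3),
ℙ-almost surely the class-posterior ratio sum tends to `0`, the posterior probability of
the class of the true labels tends to `1`, and the posterior probability of any fixed
label sequence whose class always differs from that of the true labels tends to `0`. -/
theorem posterior_convergence_as
    (Q : ℕ) (hQ : 0 < Q) (αs : Fin Q → ℝ) (πs : Fin Q → Fin Q → ℝ) (ζ γ : ℝ)
    (hprob : ProbVec αs) (hmat : MatIcc πs)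
    (hA1 : A1 πs) (hζ : 0 < ζ) (hA2 : A2 ζ πs)
    (hγ0 : 0 < γ) (hγQ : γ < 1 / Q) (hA3 : A3 γ αs)
    {Ω : Type*} [MeasurableSpace Ω] (μ : Measure Ω) [IsProbabilityMeasure μ]
    (Z : Ω → ℕ → Fin Q) (X : Ω → ℕ → ℕ → Bool)
    (hdist : ∀ (n : ℕ) (z : Fin n → Fin Q) (x : Fin n → Fin n → Bool),
      μ {ω | (∀ i : Fin n, Z ω i = z i) ∧ ∀ i j : Fin n, i ≠ j → X ω i j = x i j}
        = ENNReal.ofReal (postW αs πs x z)) :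
    (∀ᵐ ω ∂μ, Tendsto
        (fun n => classRatioSum αs πs (restrictX (X ω) n) (restrictZ (Z ω) n))
        atTop (nhds 0)) ∧
    (∀ᵐ ω ∂μ, Tendsto
        (fun n => classPosterior αs πs (restrictX (X ω) n) (restrictZ (Z ω) n))
        atTop (nhds 1)) ∧
    (∀ᵐ ω ∂μ, ∀ z : ℕ → Fin Q,
      (∀ n : ℕ, ¬ piEquiv πs (restrictZ (Z ω) n) (restrictZ z n)) →
      Tendsto (fun n => classPosterior αs πs (restrictX (X ω) n) (restrictZ z n))
        atTop (nhds 0)) := by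
  have hall : ∀ᵐ ω ∂μ, ∀ k : ℕ, ∀ᶠ n in atTop,
      0 < postW αs πs (restrictX (X ω) n) (restrictZ (Z ω) n) ∧
      classRatioSum αs πs (restrictX (X ω) n) (restrictZ (Z ω) n) < 1 / ((k : ℝ) + 1) :=
    ae_all_iff.2 fun k => aux_ae hQ hprob hmat hA1 hγ0 hA3 μ Z X hdist _
      (by positivity)
  have hR : ∀ ω, (∀ k : ℕ, ∀ᶠ n in atTop,
      0 < postW αs πs (restrictX (X ω) n) (restrictZ (Z ω) n) ∧
      classRatioSum αs πs (restrictX (X ω) n) (restrictZ (Z ω) n) < 1 / ((k : ℝ) + 1)) →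
      Tendsto (fun n => classRatioSum αs πs (restrictX (X ω) n) (restrictZ (Z ω) n))
        atTop (nhds 0) := by
    intro ω hω
    rw [Metric.tendsto_nhds]
    intro ε hε
    obtain ⟨k, hk⟩ := exists_nat_one_div_lt hε
    filter_upwards [hω k] with n hn
    rw [Real.dist_eq, sub_zero, abs_of_nonneg (aux_ratio_nonneg hmat hγ0 hA3 _ _)]
    exact hn.2.trans hk
  refine ⟨?_, ?_, ?_⟩
  · filter_upwards [hall] with ω hω
    exact hR ω hω
  · filter_upwards [hall] with ω hω
    have h1 : Tendsto (fun n => (1 + classRatioSum αs πs (restrictX (X ω) n)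
        (restrictZ (Z ω) n))⁻¹) atTop (nhds 1) := by
      have h2 := ((hR ω hω).const_add 1).inv₀ (by norm_num)
      simpa using h2
    refine h1.congr' ?_
    filter_upwards [hω 0] with n hn
    exact (aux_posterior_eq hmat hγ0 hA3 _ _ hn.1).symm
  · -- on zero vertices all label vectors coincide, so the hypothesis fails at n = 0
    refine Eventually.of_forall fun ω z hz => ?_
    exact absurd ⟨Equiv.refl _, fun _ _ => rfl, fun i => i.elim0⟩ (hz 0)
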